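/- There exists a constant C > 0, depending only on ν and μ, such that for every u₀ in the Schwartz class on ℝ one has ‖D_x S(t) P^a u₀‖_{L^∞_x L²_t} ≤ C ‖u₀‖_{L²(ℝ)}. (Kato-type smoothing estimate for the Benjamin group, Lemma 2.1, estimate (2.2).) -/

import Mathlib

open MeasureTheory Real
open scoped ENNReal NNReal Classical

noncomputable section

/-- Phase function of the linear Benjamin equation: `φ(ξ) = -ν ξ|ξ| + μ ξ³`. -/
def phase (ν μ ξ : ℝ) : ℝ := -ν * ξ * |ξ| + μ * ξ ^ 3

/-- Derivative of the phase: `φ'(ξ) = -2ν|ξ| + 3μξ²`. -/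
def dphase (ν μ ξ : ℝ) : ℝ := -2 * ν * |ξ| + 3 * μ * ξ ^ 2

/-- The frequency threshold `a = 2·max(1, |2ν/(3μ)|)`. -/
def aconst (ν μ : ℝ) : ℝ := 2 * max 1 |2 * ν / (3 * μ)|

/-- Fourier transform in the space variable. -/
def FT (f : ℝ → ℂ) (ξ : ℝ) : ℂ := ∫ x : ℝ, Complex.exp (-(Complex.I * ξ * x)) * f x

/-- Space-time Fourier transform. -/
def FT2 (u : ℝ → ℝ → ℂ) (ξ τ : ℝ) : ℂ :=
  ∫ x : ℝ, ∫ t : ℝ, Complex.exp (-(Complex.I * (ξ * x + τ * t))) * u x t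

/-- Mixed norm `‖f‖_{L^p_x L^q_t}` (with exponents in `ℝ≥0∞`). -/
def mixedLpLq (p q : ℝ≥0∞) (f : ℝ → ℝ → ℂ) : ℝ≥0∞ :=
  if p = ∞ then essSup (fun x => eLpNorm (f x) q volume) volume
  else (∫⁻ x : ℝ, eLpNorm (f x) q volume ^ p.toReal) ^ (1 / p.toReal)

/-- The Bourgain norm `‖u‖_{X_{s,b}}` associated to the Benjamin phase function. -/
def XNorm (ν μ s b : ℝ) (u : ℝ → ℝ → ℂ) : ℝ≥0∞ :=
  (∫⁻ ξ : ℝ, ∫⁻ τ : ℝ,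
      ENNReal.ofReal ((1 + ξ ^ 2) ^ s * (1 + (τ - phase ν μ ξ) ^ 2) ^ b) *
        (‖FT2 u ξ τ‖₊ : ℝ≥0∞) ^ 2) ^ (1 / 2 : ℝ)

/-- The free Benjamin group `S(t)` applied to initial data `u₀`, as a function of `(x,t)`. -/
def Sgrp (ν μ : ℝ) (u₀ : ℝ → ℂ) (x t : ℝ) : ℂ :=
  (2 * π)⁻¹ • ∫ ξ : ℝ, Complex.exp (Complex.I * (ξ * x + phase ν μ ξ * t)) * FT u₀ ξ

/-- `D_x^α S(t) P^a u₀` : the Benjamin group composed with the Fourier restriction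
`P^a` to `{|ξ| ≥ a}` and the derivative operator `D_x^α`. -/
def DSgrpPa (ν μ α : ℝ) (u₀ : ℝ → ℂ) (x t : ℝ) : ℂ :=
  (2 * π)⁻¹ • ∫ ξ : ℝ,
    if aconst ν μ ≤ |ξ| then
      (↑(|ξ| ^ α) : ℂ) * Complex.exp (Complex.I * (ξ * x + phase ν μ ξ * t)) * FT u₀ ξ
    else 0

/-- `D_x^α P^a F` acting in the space variable of a space-time function `F`. -/
def DPa (ν μ α : ℝ) (F : ℝ → ℝ → ℂ) (x t : ℝ) : ℂ :=
  (2 * π)⁻¹ • ∫ ξ : ℝ,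
    if aconst ν μ ≤ |ξ| then
      (↑(|ξ| ^ α) : ℂ) * Complex.exp (Complex.I * (ξ * x)) * FT (fun y => F y t) ξ
    else 0

lemma sq_eLpNorm_two {f : ℝ → ℂ} : eLpNorm f 2 volume ^ 2 = ∫⁻ x, ‖f x‖ₑ ^ 2 := by
  have := eLpNorm_nnreal_pow_eq_lintegral (μ := volume) (f := f) (p := 2) (by norm_num)
  simpa using this

open FourierTransform in
/-- On `L¹ ∩ L²` the `L²` Fourier transform is given by the Fourier integral. -/
lemma fourier_toLp_ae_eq {g : ℝ → ℂ} (h1 : Integrable g) (h2 : MemLp g 2) :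
    ((𝓕 (h2.toLp g) : Lp ℂ 2 (volume : Measure ℝ)) : ℝ → ℂ) =ᵐ[volume] 𝓕 g := by
  have hcont : Continuous (𝓕 g) :=
    VectorFourier.fourierIntegral_continuous Real.continuous_fourierChar
      (innerSL ℝ).continuous₂ h1
  refine ae_eq_of_integral_contDiff_smul_eq ((Lp.memLp _).locallyIntegrable (by norm_num))
    hcont.locallyIntegrable fun h hh hs => ?_
  let H : SchwartzMap ℝ ℂ :=
    HasCompactSupport.toSchwartzMap (f := fun x => (h x : ℂ))
      (hs.comp_left (g := ((↑) : ℝ → ℂ)) Complex.ofReal_zero)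
      (Complex.ofRealCLM.contDiff.comp hh)
  have hH : ∀ x, H x = (h x : ℂ) := fun x => rfl
  have key := DFunLike.congr_fun (Lp.fourier_toTemperedDistribution_eq (h2.toLp g)) H
  rw [TemperedDistribution.fourier_apply, Lp.toTemperedDistribution_apply,
    Lp.toTemperedDistribution_apply] at key
  have hflip := VectorFourier.integral_fourierIntegral_smul_eq_flip (μ := volume) (ν := volume)
    (L := innerₗ ℝ) (f := (H : ℝ → ℂ)) (g := g) Real.continuous_fourierChar
    (innerSL ℝ).continuous₂ H.integrable h1
  rw [flip_innerₗ] at hflip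
  calc ∫ x, h x • (𝓕 (h2.toLp g) : Lp ℂ 2 (volume : Measure ℝ)) x
      = ∫ x, H x • (𝓕 (h2.toLp g) : Lp ℂ 2 (volume : Measure ℝ)) x := by simp [hH]
    _ = ∫ x, (𝓕 H) x • (h2.toLp g) x := key.symm
    _ = ∫ x, (𝓕 H) x • g x := by
      refine integral_congr_ae ?_
      filter_upwards [h2.coeFn_toLp] with x hx
      rw [hx]
    _ = ∫ x, H x • 𝓕 g x := by
      rw [SchwartzMap.fourier_coe]; exact hflip
    _ = ∫ x, h x • 𝓕 g x := by simp [hH]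

open FourierTransform in
/-- **Plancherel's theorem** for the Fourier integral on `L¹ ∩ L²`. -/
lemma eLpNorm_fourier_eq {g : ℝ → ℂ} (h1 : Integrable g) (h2 : MemLp g 2) :
    eLpNorm (𝓕 g) 2 volume = eLpNorm g 2 volume := by
  rw [← eLpNorm_congr_ae (fourier_toLp_ae_eq h1 h2), ← eLpNorm_congr_ae h2.coeFn_toLp,
    ← Lp.enorm_def, ← Lp.enorm_def, ← ofReal_norm, ← ofReal_norm,
    Lp.norm_fourier_eq]

/-- An `L²` bound for an oscillatory integral with an injective phase `ψ`, obtained by using the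
phase as a new variable and applying Plancherel's theorem. -/
lemma lintegral_oscillatory_le {S : Set ℝ} (hS : MeasurableSet S) {ψ ψ' : ℝ → ℝ}
    (hψ : ∀ ξ ∈ S, HasDerivAt ψ (ψ' ξ) ξ) (hinj : Set.InjOn ψ S) (hne : ∀ ξ ∈ S, ψ' ξ ≠ 0)
    {F H : ℝ → ℂ} (hF : IntegrableOn F S) {K : ℝ} (hK : 0 ≤ K)
    (hH : ∫⁻ ξ, ‖H ξ‖ₑ ^ 2 ≠ ∞)
    (hFH : ∀ ξ ∈ S, ‖F ξ‖ ^ 2 ≤ K * |ψ' ξ| * ‖H ξ‖ ^ 2) :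
    ∫⁻ t : ℝ, ‖∫ ξ in S, Complex.exp (↑(-2 * π * ψ ξ * t) * Complex.I) * F ξ‖ₑ ^ 2
      ≤ ENNReal.ofReal K * ∫⁻ ξ, ‖H ξ‖ₑ ^ 2 := by
  have hψS : ∀ ξ ∈ S, HasDerivWithinAt ψ (ψ' ξ) S ξ := fun ξ h => (hψ ξ h).hasDerivWithinAt
  let G₀ : ℝ → ℂ := fun η => |ψ' (Function.invFunOn ψ S η)|⁻¹ • F (Function.invFunOn ψ S η)
  have hG₀ : ∀ ξ ∈ S, G₀ (ψ ξ) = |ψ' ξ|⁻¹ • F ξ := fun ξ h => by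
    simp only [G₀, hinj.leftInvOn_invFunOn h]
  have hsm : ∀ ξ ∈ S, |ψ' ξ| • G₀ (ψ ξ) = F ξ := fun ξ h => by
    rw [hG₀ ξ h, smul_smul, mul_inv_cancel₀ (abs_ne_zero.2 (hne ξ h)), one_smul]
  have hTm : MeasurableSet (ψ '' S) :=
    measurable_image_of_fderivWithin hS (fun ξ h => (hψS ξ h).hasFDerivWithinAt) hinj
  let G : ℝ → ℂ := (ψ '' S).indicator G₀
  have hG1 : Integrable G := by
    rw [integrable_indicator_iff hTm,
      integrableOn_image_iff_integrableOn_abs_deriv_smul hS hψS hinj]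
    exact hF.congr_fun (fun ξ h => (hsm ξ h).symm) hS
  have hGnorm : ∫⁻ η, ‖G η‖ₑ ^ 2 ≤ ENNReal.ofReal K * ∫⁻ ξ, ‖H ξ‖ₑ ^ 2 := by
    have e1 : ∀ η, ‖G η‖ₑ ^ 2 = (ψ '' S).indicator (fun η => ‖G₀ η‖ₑ ^ 2) η := fun η => by
      by_cases h : η ∈ ψ '' S <;> simp [G, h]
    simp_rw [e1]
    rw [lintegral_indicator hTm, lintegral_image_eq_lintegral_abs_deriv_mul hS hψS hinj,
      ← lintegral_const_mul' _ _ ENNReal.ofReal_ne_top]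
    refine (setLIntegral_mono' hS fun ξ h => ?_).trans (setLIntegral_le_lintegral _ _)
    have hpos : 0 < |ψ' ξ| := abs_pos.2 (hne ξ h)
    rw [hG₀ ξ h, ← ofReal_norm, ← ofReal_norm,
      ← ENNReal.ofReal_pow (norm_nonneg _), ← ENNReal.ofReal_pow (norm_nonneg _),
      ← ENNReal.ofReal_mul hpos.le, ← ENNReal.ofReal_mul hK]
    refine ENNReal.ofReal_le_ofReal ?_
    rw [norm_smul, norm_inv, Real.norm_eq_abs, abs_abs, mul_pow]
    have := hFH ξ h
    calc |ψ' ξ| * (|ψ' ξ|⁻¹ ^ 2 * ‖F ξ‖ ^ 2) = |ψ' ξ|⁻¹ * ‖F ξ‖ ^ 2 := by field_simp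
      _ ≤ |ψ' ξ|⁻¹ * (K * |ψ' ξ| * ‖H ξ‖ ^ 2) := by gcongr
      _ = K * ‖H ξ‖ ^ 2 := by field_simp
  have hG2 : MemLp G 2 := by
    refine ⟨hG1.aestronglyMeasurable, ?_⟩
    have : eLpNorm G 2 volume ^ 2 < ∞ := by
      rw [sq_eLpNorm_two]
      exact hGnorm.trans_lt (ENNReal.mul_lt_top ENNReal.ofReal_lt_top hH.lt_top)
    simpa using this
  have hFT : ∀ t : ℝ, ∫ ξ in S, Complex.exp (↑(-2 * π * ψ ξ * t) * Complex.I) * F ξ =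
      FourierTransform.fourier G t := fun t => by
    rw [Real.fourier_real_eq_integral_exp_smul]
    have e1 : ∀ η, Complex.exp (↑(-2 * π * η * t) * Complex.I) • G η = (ψ '' S).indicator
        (fun η => Complex.exp (↑(-2 * π * η * t) * Complex.I) • G₀ η) η := fun η => by
      by_cases h : η ∈ ψ '' S <;> simp [G, h]
    simp_rw [e1]
    rw [integral_indicator hTm, integral_image_eq_integral_abs_deriv_smul hS hψS hinj]
    refine setIntegral_congr_fun hS fun ξ h => ?_
    rw [smul_comm, hsm ξ h, smul_eq_mul]
  simp_rw [hFT]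
  rwa [← sq_eLpNorm_two, eLpNorm_fourier_eq hG1 hG2, sq_eLpNorm_two]

lemma hasDerivAt_phase (ν μ : ℝ) {ξ : ℝ} (h : ξ ≠ 0) :
    HasDerivAt (phase ν μ) (dphase ν μ ξ) ξ := by
  have h1 := (((hasDerivAt_id ξ).const_mul (-ν)).mul (hasDerivAt_abs h)).add
    ((hasDerivAt_pow 3 ξ).const_mul μ)
  refine h1.congr_deriv ?_
  have : ξ * (SignType.sign ξ : ℝ) = |ξ| := by rw [mul_comm]; exact sign_mul_self ξ
  simp only [id, dphase]
  push_cast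
  linear_combination (-ν) * this

lemma aconst_pos (ν μ : ℝ) : 0 < aconst ν μ := by
  have := le_max_left 1 |2 * ν / (3 * μ)|
  unfold aconst; linarith

lemma abs_div_le_aconst (ν μ : ℝ) : |ν / μ| ≤ 3 / 4 * aconst ν μ := by
  have h := le_max_right 1 |2 * ν / (3 * μ)|
  have e : 2 * ν / (3 * μ) = 2 / 3 * (ν / μ) := by rw [mul_div_mul_comm]
  rw [e, abs_mul, abs_of_pos (by norm_num : (0 : ℝ) < 2 / 3)] at h
  unfold aconst; rw [e, abs_mul, abs_of_pos (by norm_num : (0 : ℝ) < 2 / 3)]; linarith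

lemma le_abs_dphase {ν μ : ℝ} (hμ : μ ≠ 0) {ξ : ℝ} (h : aconst ν μ ≤ |ξ|) :
    3 / 2 * |μ| * ξ ^ 2 ≤ |dphase ν μ ξ| := by
  have hr := (abs_le.1 (abs_div_le_aconst ν μ)).2
  have e : dphase ν μ ξ = μ * (|ξ| * (3 * |ξ| - 2 * (ν / μ))) := by
    unfold dphase; rw [← sq_abs ξ]; field_simp; ring
  have hξ := abs_nonneg ξ
  have hp : 3 / 2 * |ξ| ≤ 3 * |ξ| - 2 * (ν / μ) := by linarith
  rw [e, abs_mul, abs_of_nonneg (mul_nonneg hξ (by linarith)), ← sq_abs ξ]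
  have := mul_le_mul_of_nonneg_left (mul_le_mul_of_nonneg_left hp hξ) (abs_nonneg μ)
  linarith

lemma phase_injOn {ν μ : ℝ} (hμ : μ ≠ 0) :
    Set.InjOn (phase ν μ) {ξ | aconst ν μ ≤ |ξ|} := by
  obtain ⟨hr1, hr2⟩ := abs_le.1 (abs_div_le_aconst ν μ)
  have ha := aconst_pos ν μ
  generalize hA : aconst ν μ = a at *
  generalize hR : ν / μ = r at *
  have e : ∀ ξ, phase ν μ ξ = μ * (ξ ^ 3 - r * (ξ * |ξ|)) := fun ξ => by
    rw [← hR]; unfold phase; field_simp; ring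
  have hpos : ∀ x y, a ≤ x → a ≤ y → x ^ 3 - r * (x * x) = y ^ 3 - r * (y * y) → x = y := by
    intro x y hx hy h
    have hf : (x - y) * (x * x + x * y + y * y - r * (x + y)) = 0 := by linear_combination h
    rcases mul_eq_zero.1 hf with h0 | h0
    · linarith
    · nlinarith [mul_pos (ha.trans_le hx) (ha.trans_le hy),
        mul_le_mul_of_nonneg_right (hr2.trans (by linarith : 3 / 4 * a ≤ x)) (ha.trans_le hx).le,
        mul_le_mul_of_nonneg_right (hr2.trans (by linarith : 3 / 4 * a ≤ y)) (ha.trans_le hy).le]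
  have hsgn : ∀ x, a ≤ x → 0 < x ^ 3 - r * (x * x) := by
    intro x hx
    have hx0 := ha.trans_le hx
    have := mul_pos (mul_pos hx0 hx0) (by linarith : 0 < x - r)
    linarith
  intro x hx y hy h
  rw [e, e] at h
  have h := mul_left_cancel₀ hμ h
  simp only [Set.mem_ofPred_eq] at hx hy
  rcases le_or_gt 0 x with hx0 | hx0 <;> rcases le_or_gt 0 y with hy0 | hy0
  · rw [abs_of_nonneg hx0] at hx h
    rw [abs_of_nonneg hy0] at hy h
    exact hpos x y hx hy h
  · rw [abs_of_nonneg hx0] at hx h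
    rw [abs_of_neg hy0] at hy h
    linarith [hsgn x hx, hsgn (-y) hy]
  · rw [abs_of_neg hx0] at hx h
    rw [abs_of_nonneg hy0] at hy h
    linarith [hsgn (-x) hx, hsgn y hy]
  · rw [abs_of_neg hx0] at hx h
    rw [abs_of_neg hy0] at hy h
    linarith [hpos (-x) (-y) hx hy (by linear_combination -h)]

lemma FT_eq_fourier (u : SchwartzMap ℝ ℂ) (ξ : ℝ) :
    FT (fun x => u x) ξ = (FourierTransform.fourier u : SchwartzMap ℝ ℂ) (ξ / (2 * π)) := by
  rw [SchwartzMap.fourier_coe, Real.fourier_real_eq_integral_exp_smul, FT]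
  congr 1 with x
  rw [smul_eq_mul]
  congr 2
  push_cast
  field_simp

lemma lintegral_FT_sq (u : SchwartzMap ℝ ℂ) :
    ∫⁻ ξ, ‖FT (fun x => u x) ξ‖ₑ ^ 2 =
      ENNReal.ofReal (2 * π) * eLpNorm (fun x => u x) 2 volume ^ 2 := by
  have hπ : (0 : ℝ) < 2 * π := by positivity
  have hsub := lintegral_image_eq_lintegral_abs_deriv_mul (s := Set.univ)
    (f := fun x : ℝ => 2 * π * x) (f' := fun _ => 2 * π) MeasurableSet.univ
    (fun x _ => (by simpa using (hasDerivAt_id x).const_mul (2 * π) :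
      HasDerivAt (fun x : ℝ => 2 * π * x) (2 * π) x).hasDerivWithinAt)
    (fun x _ y _ h => mul_left_cancel₀ hπ.ne' h) (fun ξ => ‖FT (fun x => u x) ξ‖ₑ ^ 2)
  have himg : (fun x : ℝ => 2 * π * x) '' Set.univ = Set.univ := by
    rw [Set.image_univ]; exact (mul_left_surjective₀ hπ.ne').range_eq
  rw [himg, Measure.restrict_univ, abs_of_pos hπ] at hsub
  rw [hsub, lintegral_const_mul' _ _ ENNReal.ofReal_ne_top]
  congr 1
  simp_rw [FT_eq_fourier, mul_div_cancel_left₀ _ hπ.ne']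
  rw [← sq_eLpNorm_two, SchwartzMap.fourier_coe]
  rw [eLpNorm_fourier_eq u.integrable (u.memLp 2 volume)]

lemma integrable_abs_mul_FT (u : SchwartzMap ℝ ℂ) (x : ℝ) :
    Integrable fun ξ : ℝ => (2 * π : ℂ)⁻¹ *
      (((|ξ| : ℝ) : ℂ) * Complex.exp (Complex.I * (ξ * x)) * FT (fun x => u x) ξ) := by
  have hπ : (0 : ℝ) < 2 * π := by positivity
  refine Integrable.const_mul ?_ _
  have hi := (((FourierTransform.fourier u : SchwartzMap ℝ ℂ).integrable_pow_mul volume 1).comp_div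
    hπ.ne').const_mul (2 * π)
  have hc : Continuous fun ξ => FT (fun x => u x) ξ := by
    simp_rw [FT_eq_fourier]
    exact (FourierTransform.fourier u : SchwartzMap ℝ ℂ).continuous.comp
      (continuous_id.div_const _)
  refine hi.mono' (Continuous.aestronglyMeasurable (by fun_prop)) (ae_of_all _ fun ξ => ?_)
  have hexp : ‖Complex.exp (Complex.I * (ξ * x))‖ = 1 := by
    rw [mul_comm]; exact_mod_cast Complex.norm_exp_ofReal_mul_I (ξ * x)
  rw [norm_mul, norm_mul, hexp, FT_eq_fourier, pow_one, norm_div, Real.norm_of_nonneg hπ.le,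
    Complex.norm_real, norm_eq_abs, norm_eq_abs, abs_abs, mul_one]
  exact le_of_eq (by field_simp)

lemma DSgrpPa_one_eq (ν μ : ℝ) (u : ℝ → ℂ) (x t : ℝ) :
    DSgrpPa ν μ 1 u x t = ∫ ξ in {ξ | aconst ν μ ≤ |ξ|},
      Complex.exp (↑(-2 * π * (-(2 * π)⁻¹ * phase ν μ ξ) * t) * Complex.I) *
        ((2 * π : ℂ)⁻¹ * (((|ξ| : ℝ) : ℂ) * Complex.exp (Complex.I * (ξ * x)) * FT u ξ)) := by
  have hS : MeasurableSet {ξ : ℝ | aconst ν μ ≤ |ξ|} :=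
    (isClosed_le continuous_const continuous_abs).measurableSet
  rw [DSgrpPa, ← integral_smul, ← integral_indicator hS]
  congr 1 with ξ
  by_cases h : ξ ∈ {ξ : ℝ | aconst ν μ ≤ |ξ|}
  · have hπ : (π : ℂ) ≠ 0 := by exact_mod_cast pi_ne_zero
    rw [Set.indicator_of_mem h, if_pos (by exact h), rpow_one, mul_add, Complex.exp_add, Complex.real_smul]
    have e : (↑(-2 * π * (-(2 * π)⁻¹ * phase ν μ ξ) * t) * Complex.I : ℂ) =
        Complex.I * (phase ν μ ξ * t) := by
      push_cast; field_simp
    rw [e]; push_cast; ring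
  · rw [Set.indicator_of_notMem h, if_neg (by exact h), smul_zero]

/-- **Lemma 2.1, estimate (2.2)** (Kato-type smoothing for the Benjamin group):
there is `C > 0`, depending only on `ν` and `μ`, such that for every Schwartz
datum `u₀` one has `‖D_x S(t) P^a u₀‖_{L^∞_x L²_t} ≤ C ‖u₀‖_{L²}`. -/
theorem benjamin_kato_smoothing (ν μ : ℝ) (hμ : μ ≠ 0) :
    ∃ C > (0 : ℝ), ∀ u₀ : SchwartzMap ℝ ℂ,
      mixedLpLq ∞ 2 (DSgrpPa ν μ 1 (fun x => u₀ x)) ≤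
        ENNReal.ofReal C * eLpNorm (fun x => u₀ x) 2 volume := by
  have hμ' : 0 < |μ| := abs_pos.2 hμ
  have hπ := pi_pos
  set K : ℝ := (3 * π * |μ|)⁻¹ with hK
  have hK0 : 0 < K := by positivity
  refine ⟨√(K * (2 * π)), by positivity, fun u₀ => ?_⟩
  rw [mixedLpLq, if_pos rfl]
  refine essSup_le_of_ae_le _ (ae_of_all _ fun x => ?_)
  have hS : MeasurableSet {ξ : ℝ | aconst ν μ ≤ |ξ|} :=
    (isClosed_le continuous_const continuous_abs).measurableSet
  have hne : ∀ ξ ∈ {ξ : ℝ | aconst ν μ ≤ |ξ|}, ξ ≠ 0 := fun ξ h =>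
    abs_pos.1 ((aconst_pos ν μ).trans_le h)
  have hmain := lintegral_oscillatory_le (K := K) hS (ψ := fun ξ => -(2 * π)⁻¹ * phase ν μ ξ)
    (ψ' := fun ξ => -(2 * π)⁻¹ * dphase ν μ ξ)
    (fun ξ h => (hasDerivAt_phase ν μ (hne ξ h)).const_mul _)
    (fun ξ h η h' e => phase_injOn hμ h h' (mul_left_cancel₀ (by simp [hπ.ne']) e))
    (fun ξ h => mul_ne_zero (by simp [hπ.ne']) (abs_pos.1 (lt_of_lt_of_le
      (by have := sq_pos_of_ne_zero (hne ξ h); positivity) (le_abs_dphase hμ h))))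
    (integrable_abs_mul_FT u₀ x).integrableOn hK0.le (H := FT (fun x => u₀ x))
    (by
      rw [lintegral_FT_sq]
      exact ENNReal.mul_ne_top ENNReal.ofReal_ne_top
        (ENNReal.pow_ne_top (u₀.memLp 2 volume).eLpNorm_ne_top))
    (fun ξ h => by
      have hd := le_abs_dphase hμ h
      have hexp : ‖Complex.exp (Complex.I * (ξ * x))‖ = 1 := by
        rw [mul_comm]; exact_mod_cast Complex.norm_exp_ofReal_mul_I (ξ * x)
      have h2 : ‖(2 * π : ℂ)⁻¹‖ = (2 * π)⁻¹ := by simp [abs_of_pos hπ]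
      rw [norm_mul, norm_mul, norm_mul, hexp, h2, Complex.norm_real, norm_eq_abs, abs_abs, mul_one,
        mul_pow, mul_pow, sq_abs, ← mul_assoc]
      refine mul_le_mul_of_nonneg_right ?_ (sq_nonneg _)
      rw [abs_mul, abs_neg, abs_of_pos (by positivity : 0 < (2 * π)⁻¹)]
      calc (2 * π)⁻¹ ^ 2 * ξ ^ 2 = K * ((2 * π)⁻¹ * (3 / 2 * |μ| * ξ ^ 2)) := by
            rw [hK]; field_simp
        _ ≤ _ := by gcongr)
  simp_rw [← DSgrpPa_one_eq] at hmain
  rw [← sq_eLpNorm_two, lintegral_FT_sq, ← mul_assoc, ← ENNReal.ofReal_mul hK0.le] at hmain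
  refine (ENNReal.pow_le_pow_left_iff two_ne_zero).1 (hmain.trans_eq ?_)
  rw [mul_pow, ← ENNReal.ofReal_pow (sqrt_nonneg _), sq_sqrt (by positivity)]
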